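/- arXiv:1611.08367 — 4 statements merged into one kernel-verified Lean document; each statement's English description precedes it below -/
import Mathlib

section
/- Let H : 2^V → ℝ be a polymatroid rank function on a finite set V with |V| ≥ 2. For every α ∈ ℝ, there exists r ∈ RCO(V) with r(V) = α if and only if α ≥ R_ACO(V) := max_{P ∈ Π′(V)} φ(P). In other words, a sum-rate α is achievable for communication for omniscience exactly when α is at least the maximum over partitions P ∈ Π′(V) of Σ_{C∈P} (H(V) − H(C)) / (|P| − 1). -/
/-- `H` is a polymatroid rank function: normalized, monotone and submodular. -/
def IsPolymatroid {V : Type*} [Fintype V] [DecidableEq V] (H : Finset V → ℝ) : Prop :=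
  H ∅ = 0 ∧ (∀ X Y : Finset V, Y ⊆ X → H Y ≤ H X) ∧
    (∀ X Y : Finset V, H (X ∪ Y) + H (X ∩ Y) ≤ H X + H Y)

/-- `P` is a partition of `X`: a collection of pairwise disjoint nonempty sets with union `X`. -/
def IsPartitionOf {V : Type*} [DecidableEq V] (X : Finset V) (P : Finset (Finset V)) : Prop :=
  (∀ C ∈ P, C.Nonempty) ∧ (∀ C ∈ P, ∀ D ∈ P, C ≠ D → Disjoint C D) ∧ P.biUnion id = X

/-- `φ(P) = Σ_{C∈P} (H(V) − H(C)) / (|P| − 1)`. -/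
noncomputable def phi {V : Type*} [Fintype V] [DecidableEq V]
    (H : Finset V → ℝ) (P : Finset (Finset V)) : ℝ :=
  (∑ C ∈ P, (H Finset.univ - H C)) / ((P.card : ℝ) - 1)

/-- The achievable rate region for communication for omniscience:
`r(X) ≥ H(V) − H(V∖X)` for all proper subsets `X ⊊ V`. -/
def RCO {V : Type*} [Fintype V] [DecidableEq V] (H : Finset V → ℝ) : Set (V → ℝ) :=
  { r | ∀ X : Finset V, X ⊂ Finset.univ →
      H Finset.univ - H (Finset.univ \ X) ≤ ∑ i ∈ X, r i }

/-- The total weight of a finite set is the sum of the weights of the parts of a partition. -/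
theorem IsPartitionOf.sum_sum {V : Type*} [DecidableEq V] {X : Finset V}
    {P : Finset (Finset V)} (hP : IsPartitionOf X P) (r : V → ℝ) :
    ∑ C ∈ P, ∑ i ∈ C, r i = ∑ i ∈ X, r i := by
  rw [← hP.2.2, Finset.sum_biUnion]
  · rfl
  · intro C hC D hD hCD
    exact hP.2.1 C hC D hD hCD

/-- For every set `S` there is a vector dominated by `f` on nonempty sets in which each
element of `S` lies in a tight set. -/
theorem exists_dominated_tight_on {V : Type*} [Fintype V] [DecidableEq V]
    (f : Finset V → ℝ) (S : Finset V) :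
    ∃ r : V → ℝ, (∀ X : Finset V, X.Nonempty → ∑ i ∈ X, r i ≤ f X) ∧
      ∀ i ∈ S, ∃ X : Finset V, i ∈ X ∧ ∑ j ∈ X, r j = f X := by
  induction S using Finset.induction_on with
  | empty =>
    refine ⟨fun _ => -∑ Y : Finset V, |f Y|, fun X hX => ?_, by simp⟩
    have hf : |f X| ≤ ∑ Y : Finset V, |f Y| :=
      Finset.single_le_sum (f := fun Y => |f Y|) (fun _ _ => abs_nonneg _) (Finset.mem_univ X)
    have hcard : (1 : ℝ) ≤ X.card := by exact_mod_cast hX.card_pos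
    have := neg_abs_le (f X)
    have := abs_nonneg (f X)
    rw [Finset.sum_const, nsmul_eq_mul]
    nlinarith
  | insert a S _ ih =>
    obtain ⟨r, hr, hS⟩ := ih
    obtain ⟨X₀, hX₀, hmin⟩ := Finset.exists_min_image
      (Finset.univ.filter fun X : Finset V => a ∈ X) (fun X => f X - ∑ j ∈ X, r j)
      ⟨{a}, by simp⟩
    simp only [Finset.mem_filter, Finset.mem_univ, true_and] at hX₀ hmin
    set δ := f X₀ - ∑ j ∈ X₀, r j with hδ
    have hδ₀ : 0 ≤ δ := sub_nonneg.2 (hr X₀ ⟨a, hX₀⟩)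
    have hsum (X : Finset V) : ∑ j ∈ X, (r j + if j = a then δ else 0) =
        ∑ j ∈ X, r j + if a ∈ X then δ else 0 := by
      rw [Finset.sum_add_distrib, Finset.sum_ite_eq']
    refine ⟨fun j => r j + if j = a then δ else 0, fun X hX => ?_, fun i hi => ?_⟩
    · rw [hsum]
      split_ifs with ha
      · linarith [hmin X ha]
      · linarith [hr X hX]
    · rcases Finset.mem_insert.1 hi with rfl | hi
      · exact ⟨X₀, hX₀, by rw [hsum, if_pos hX₀]; linarith⟩
      · obtain ⟨X, hiX, hX⟩ := hS i hi
        refine ⟨X, hiX, ?_⟩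
        rw [hsum]
        split_ifs with ha
        · linarith [hmin X ha]
        · linarith

/-- If every element lies in a tight set and `f` is submodular on intersecting pairs, then some
partition consists of tight sets. -/
theorem exists_partition_tight {V : Type*} [Fintype V] [DecidableEq V]
    (f : Finset V → ℝ)
    (hf : ∀ X Y : Finset V, (X ∩ Y).Nonempty → f (X ∪ Y) + f (X ∩ Y) ≤ f X + f Y)
    (r : V → ℝ) (hr : ∀ X : Finset V, X.Nonempty → ∑ i ∈ X, r i ≤ f X)
    (ht : ∀ i, ∃ X : Finset V, i ∈ X ∧ ∑ j ∈ X, r j = f X) :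
    ∃ P : Finset (Finset V), IsPartitionOf Finset.univ P ∧ ∀ C ∈ P, ∑ j ∈ C, r j = f C := by
  have hunion (X Y : Finset V) (hX : ∑ j ∈ X, r j = f X) (hY : ∑ j ∈ Y, r j = f Y)
      (hXY : (X ∩ Y).Nonempty) : ∑ j ∈ X ∪ Y, r j = f (X ∪ Y) := by
    have h₁ := hr _ hXY
    have h₂ := hr (X ∪ Y) (hXY.mono (Finset.inter_subset_left.trans Finset.subset_union_left))
    have h₃ := Finset.sum_union_inter (s₁ := X) (s₂ := Y) (f := r)
    linarith [hf X Y hXY]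
  have hmax (i : V) : ∃ T : Finset V, i ∈ T ∧ ∑ j ∈ T, r j = f T ∧
      ∀ X : Finset V, i ∈ X → ∑ j ∈ X, r j = f X → X ⊆ T := by
    obtain ⟨X, hiX, hX⟩ := ht i
    obtain ⟨T, hT, hTmax⟩ := Finset.exists_max_image
      (Finset.univ.filter fun X : Finset V => i ∈ X ∧ ∑ j ∈ X, r j = f X) Finset.card
      ⟨X, by simp [hiX, hX]⟩
    simp only [Finset.mem_filter, Finset.mem_univ, true_and] at hT hTmax
    refine ⟨T, hT.1, hT.2, fun Y hiY hY => ?_⟩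
    have hcard := hTmax (T ∪ Y) ⟨Finset.mem_union_left _ hT.1,
      hunion T Y hT.2 hY ⟨i, Finset.mem_inter.2 ⟨hT.1, hiY⟩⟩⟩
    rw [Finset.eq_of_subset_of_card_le Finset.subset_union_left hcard]
    exact Finset.subset_union_right
  choose T hmem htight hT using hmax
  refine ⟨Finset.univ.image T, ⟨?_, ?_, ?_⟩, ?_⟩
  · simp only [Finset.mem_image, Finset.mem_univ, true_and, forall_exists_index,
      forall_apply_eq_imp_iff]
    exact fun i => ⟨i, hmem i⟩
  · simp only [Finset.mem_image, Finset.mem_univ, true_and, forall_exists_index,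
      forall_apply_eq_imp_iff]
    intro i j hij
    by_contra hdisj
    have hu := hunion _ _ (htight i) (htight j)
      (Finset.not_disjoint_iff_nonempty_inter.1 hdisj)
    have hi := hT i _ (Finset.mem_union_left _ (hmem i)) hu
    have hj := hT j _ (Finset.mem_union_right _ (hmem j)) hu
    exact hij ((Finset.subset_union_left.trans hj).antisymm
      (Finset.subset_union_right.trans hi))
  · ext i
    simp only [Finset.mem_biUnion, Finset.mem_image, Finset.mem_univ, true_and, id, iff_true]
    exact ⟨T i, ⟨i, rfl⟩, hmem i⟩
  · simp only [Finset.mem_image, Finset.mem_univ, true_and, forall_exists_index,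
      forall_apply_eq_imp_iff]
    exact htight

/-- An intersecting submodular function satisfying `f(V) ≤ Σ_{C∈P} f(C)` for all partitions `P`
with at least two parts has a nonempty base polyhedron. -/
theorem exists_base_of_le_partition_sum {V : Type*} [Fintype V] [DecidableEq V] [Nonempty V]
    (f : Finset V → ℝ)
    (hf : ∀ X Y : Finset V, (X ∩ Y).Nonempty → f (X ∪ Y) + f (X ∩ Y) ≤ f X + f Y)
    (hP : ∀ P : Finset (Finset V), IsPartitionOf Finset.univ P → 2 ≤ P.card →
      f Finset.univ ≤ ∑ C ∈ P, f C) :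
    ∃ r : V → ℝ, (∀ X : Finset V, X.Nonempty → ∑ i ∈ X, r i ≤ f X) ∧
      ∑ i, r i = f Finset.univ := by
  obtain ⟨r, hr, ht⟩ := exists_dominated_tight_on f Finset.univ
  refine ⟨r, hr, (hr _ Finset.univ_nonempty).antisymm ?_⟩
  obtain ⟨P, hpart, htight⟩ :=
    exists_partition_tight f hf r hr fun i => ht i (Finset.mem_univ i)
  rw [← hpart.sum_sum, Finset.sum_congr rfl htight]
  rcases lt_or_ge P.card 2 with hcard | hcard
  · have hne : P.Nonempty := by
      rw [Finset.nonempty_iff_ne_empty]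
      rintro rfl
      exact Finset.univ_nonempty.ne_empty hpart.2.2.symm
    obtain ⟨C, rfl⟩ := Finset.card_eq_one.1 (by have := hne.card_pos; omega : P.card = 1)
    have hC : C = Finset.univ := by simpa using hpart.2.2
    simp [hC]
  · exact hP P hpart hcard

/-- `φ(P)` is a lower bound on the sum-rate of every achievable rate vector. -/
theorem phi_le_sum_of_mem_RCO {V : Type*} [Fintype V] [DecidableEq V] {H : Finset V → ℝ}
    {r : V → ℝ} (hr : r ∈ RCO H) {P : Finset (Finset V)}
    (hP : IsPartitionOf Finset.univ P) (hcard : 2 ≤ P.card) : phi H P ≤ ∑ i, r i := by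
  have hcard' : (2 : ℝ) ≤ P.card := by exact_mod_cast hcard
  have hle : ∀ C ∈ P, H Finset.univ - H C ≤ ∑ i, r i - ∑ i ∈ C, r i := by
    intro C hC
    have hproper : Finset.univ \ C ⊂ Finset.univ :=
      Finset.sdiff_ssubset (Finset.subset_univ C) (hP.1 C hC)
    have h := hr _ hproper
    rw [Finset.sdiff_sdiff_eq_self (Finset.subset_univ C)] at h
    linarith [Finset.sum_sdiff (f := r) (Finset.subset_univ C)]
  have h := Finset.sum_le_sum hle
  rw [Finset.sum_sub_distrib (fun _ => ∑ i, r i), Finset.sum_const, nsmul_eq_mul,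
    hP.sum_sum] at h
  rw [phi, div_le_iff₀ (by linarith)]
  linarith

/-- A sum-rate `α` is achievable if and only if `α ≥ R_ACO(V) = max_{P ∈ Π′(V)} φ(P)`. -/
theorem stmt_5 {V : Type*} [Fintype V] [DecidableEq V] (hV : 2 ≤ Fintype.card V)
    (H : Finset V → ℝ) (hH : IsPolymatroid H) (R : ℝ)
    (hR : IsGreatest { s : ℝ | ∃ P : Finset (Finset V),
      IsPartitionOf Finset.univ P ∧ 2 ≤ P.card ∧ s = phi H P } R) :
    ∀ α : ℝ, (∃ r ∈ RCO H, ∑ i, r i = α) ↔ R ≤ α := by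
  intro α
  constructor
  · rintro ⟨r, hr, rfl⟩
    obtain ⟨P, hP, hcard, rfl⟩ := hR.1
    exact phi_le_sum_of_mem_RCO hr hP hcard
  · intro hα
    have : Nonempty V := Fintype.card_pos_iff.1 (by omega)
    obtain ⟨r, hr, hsum⟩ := exists_base_of_le_partition_sum
      (fun X => α - H Finset.univ + H X) (fun X Y _ => by linarith [hH.2.2 X Y])
      (fun P hP hcard => by
        have hφ : phi H P ≤ α := (hR.2 ⟨P, hP, hcard, rfl⟩).trans hα
        have hcard' : (2 : ℝ) ≤ P.card := by exact_mod_cast hcard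
        rw [phi, div_le_iff₀ (by linarith), Finset.sum_sub_distrib, Finset.sum_const,
          nsmul_eq_mul] at hφ
        rw [Finset.sum_add_distrib, Finset.sum_const, nsmul_eq_mul]
        linarith)
    have hsum' : ∑ i, r i = α := by linarith
    refine ⟨r, fun X hX => ?_, hsum'⟩
    have h := hr (Finset.univ \ X) (Finset.sdiff_nonempty.2 hX.2)
    linarith [Finset.sum_sdiff (f := r) hX.1]
end

section
/- Let H : 2^V → ℝ be a polymatroid rank function on a finite set V with |V| = 3. Then the lower bound of Proposition 1 is tight for the asymptotic model: max_{P ∈ Π′(V)} φ(P) = max{ max_{i ∈ V} ( 2H(V) − H({i}) − H(V∖{i}) ), (1/2) Σ_{i∈V} ( H(V) − H({i}) ) }, and this common value equals the minimum of r(V) over r ∈ RCO(V). -/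
/-- The box `l ≤ r ≤ u` meets the plane `∑ i, r i = M` as soon as
`l ≤ u` and `∑ i, l i ≤ M ≤ ∑ i, u i`. -/
theorem exists_sum_eq_of_mem_box {V : Type*} [Fintype V] {l u : V → ℝ} {M : ℝ} (hlu : ∀ i, l i ≤ u i)
    (hl : ∑ i, l i ≤ M) (hu : M ≤ ∑ i, u i) :
    ∃ r : V → ℝ, (∀ i, l i ≤ r i ∧ r i ≤ u i) ∧ ∑ i, r i = M := by
  rcases eq_or_lt_of_le (hl.trans hu) with h | h
  · exact ⟨l, fun i => ⟨le_rfl, hlu i⟩, by linarith⟩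
  · set t := (M - ∑ i, l i) / (∑ i, u i - ∑ i, l i) with ht
    have h0 : 0 ≤ t := div_nonneg (by linarith) (by linarith)
    have h1 : t ≤ 1 := (div_le_one (by linarith)).2 (by linarith)
    refine ⟨fun i => l i + t * (u i - l i), fun i => ⟨?_, ?_⟩, ?_⟩
    · nlinarith [hlu i]
    · nlinarith [hlu i]
    · rw [Finset.sum_add_distrib, ← Finset.mul_sum, Finset.sum_sub_distrib, ht,
        div_mul_cancel₀ _ (by linarith)]
      ring

/-- On a three-element set, membership in the rate region is a two-sided bound on each rate. -/
theorem mem_RCO_of_card_eq_three {V : Type*} [Fintype V] [DecidableEq V]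
    (hV : Fintype.card V = 3) {H : Finset V → ℝ} {r : V → ℝ}
    (hlower : ∀ i, H Finset.univ - H (Finset.univ \ {i}) ≤ r i)
    (hupper : ∀ i, r i ≤ ∑ j, r j - H Finset.univ + H {i}) : r ∈ RCO H := by
  intro X hX
  have hlt : X.card < 3 := by
    rw [← hV, ← Finset.card_univ]
    exact Finset.card_lt_card hX
  have hcompl : (Finset.univ \ X).card = 3 - X.card := by
    rw [Finset.card_sdiff_of_subset (Finset.subset_univ X), Finset.card_univ, hV]
  obtain h | h | h : X.card = 0 ∨ X.card = 1 ∨ X.card = 2 := by omega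
  · rw [Finset.card_eq_zero.1 h]
    simp
  · obtain ⟨i, rfl⟩ := Finset.card_eq_one.1 h
    simpa using hlower i
  · rw [h] at hcompl
    obtain ⟨i, hi⟩ := Finset.card_eq_one.1 hcompl
    have hsum := Finset.sum_sdiff (f := r) (Finset.subset_univ X)
    rw [hi, Finset.sum_singleton] at hsum
    rw [hi]
    linarith [hupper i]

/-- On a three-element set, any `M` dominating the two-cell and singleton lower bounds is an
achievable sum-rate. -/
theorem exists_mem_RCO_sum_eq {V : Type*} [Fintype V] [DecidableEq V]
    (hV : Fintype.card V = 3) {H : Finset V → ℝ} (hH : IsPolymatroid H) {M : ℝ}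
    (hpair : ∀ i, 2 * H Finset.univ - H {i} - H (Finset.univ \ {i}) ≤ M)
    (hsingle : (1 / 2) * ∑ i, (H Finset.univ - H {i}) ≤ M) :
    ∃ r ∈ RCO H, ∑ i, r i = M := by
  have hl : ∑ i, (H Finset.univ - H (Finset.univ \ {i})) ≤ M := by
    obtain ⟨a, b, c, hab, hac, hbc, huniv⟩ :=
      Finset.card_eq_three.1 (Finset.card_univ.trans hV)
    have hsub := hH.2.2 (Finset.univ \ {b}) (Finset.univ \ {c})
    have hcup : (Finset.univ \ {b}) ∪ (Finset.univ \ {c}) = (Finset.univ : Finset V) := by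
      ext x
      by_cases hx : x = b <;> simp [hx, hbc]
    have hcap : (Finset.univ \ {b}) ∩ (Finset.univ \ {c}) = ({a} : Finset V) := by
      rw [huniv]
      ext x
      simp only [Finset.mem_inter, Finset.mem_sdiff, Finset.mem_insert, Finset.mem_singleton]
      grind
    rw [hcup, hcap] at hsub
    have hexpand : ∀ f : V → ℝ, ∑ i, f i = f a + f b + f c := by
      intro f
      rw [huniv, Finset.sum_insert (by simp [hab, hac]), Finset.sum_pair hbc, add_assoc]
    rw [hexpand]
    linarith [hpair a]
  have hu : M ≤ ∑ i, (M - H Finset.univ + H {i}) := by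
    rw [Finset.sum_sub_distrib, Finset.sum_const, Finset.card_univ, hV] at hsingle
    rw [Finset.sum_add_distrib, Finset.sum_const, Finset.card_univ, hV]
    simp only [nsmul_eq_mul, Nat.cast_ofNat] at hsingle ⊢
    linarith
  obtain ⟨r, hr, hsum⟩ := exists_sum_eq_of_mem_box (fun i => by linarith [hpair i]) hl hu
  refine ⟨r, mem_RCO_of_card_eq_three hV (fun i => (hr i).1) fun i => ?_, hsum⟩
  rw [hsum]
  exact (hr i).2

/-- The partition of a set with at least two elements into `{i}` and its complement. -/
theorem exists_partition_phi_eq_pair {V : Type*} [Fintype V] [DecidableEq V]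
    (hV : 2 ≤ Fintype.card V) (H : Finset V → ℝ) (i : V) :
    ∃ P : Finset (Finset V), IsPartitionOf Finset.univ P ∧ 2 ≤ P.card ∧
      2 * H Finset.univ - H {i} - H (Finset.univ \ {i}) = phi H P := by
  have hne : ({i} : Finset V) ≠ Finset.univ \ {i} := by
    intro h
    have : i ∈ Finset.univ \ {i} := h ▸ Finset.mem_singleton_self i
    simp at this
  have hnonempty : (Finset.univ \ {i} : Finset V).Nonempty := by
    rw [← Finset.card_pos, Finset.card_sdiff_of_subset (Finset.subset_univ _),
      Finset.card_univ, Finset.card_singleton]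
    omega
  refine ⟨{{i}, Finset.univ \ {i}}, ⟨?_, ?_, ?_⟩, (Finset.card_pair hne).ge, ?_⟩
  · simpa using hnonempty
  · intro C hC D hD hCD
    simp only [Finset.mem_insert, Finset.mem_singleton] at hC hD
    rcases hC with rfl | rfl <;> rcases hD with rfl | rfl
    · exact absurd rfl hCD
    · exact Finset.disjoint_sdiff
    · exact Finset.sdiff_disjoint
    · exact absurd rfl hCD
  · ext x
    simp
  · rw [phi, Finset.card_pair hne, Finset.sum_pair hne]
    norm_num
    ring

/-- The partition of a three-element set into singletons. -/
theorem exists_partition_phi_eq_singletons {V : Type*} [Fintype V] [DecidableEq V]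
    (hV : Fintype.card V = 3) (H : Finset V → ℝ) :
    ∃ P : Finset (Finset V), IsPartitionOf Finset.univ P ∧ 2 ≤ P.card ∧
      (1 / 2) * ∑ i, (H Finset.univ - H {i}) = phi H P := by
  have hinj : Function.Injective (fun i : V => ({i} : Finset V)) := Finset.singleton_injective
  have hcard : (Finset.univ.image fun i : V => ({i} : Finset V)).card = 3 := by
    rw [Finset.card_image_of_injective _ hinj, Finset.card_univ, hV]
  refine ⟨Finset.univ.image fun i : V => {i}, ⟨?_, ?_, ?_⟩, by omega, ?_⟩
  · simp
  · intro C hC D hD hCD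
    simp only [Finset.mem_image, Finset.mem_univ, true_and] at hC hD
    obtain ⟨i, rfl⟩ := hC
    obtain ⟨j, rfl⟩ := hD
    exact Finset.disjoint_singleton.2 fun h => hCD (h ▸ rfl)
  · ext x
    simp
  · rw [phi, hcard, Finset.sum_image hinj.injOn]
    norm_num
    ring

/-- For `|V| = 3`, the lower bound of Proposition 1 is tight: it equals
`max_{P ∈ Π′(V)} φ(P)`, which in turn is the minimum achievable sum-rate. -/
theorem stmt_9 {V : Type*} [Fintype V] [DecidableEq V] (hV : Fintype.card V = 3)
    (H : Finset V → ℝ) (hH : IsPolymatroid H) :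
    IsGreatest { s : ℝ | ∃ P : Finset (Finset V),
        IsPartitionOf Finset.univ P ∧ 2 ≤ P.card ∧ s = phi H P }
      (max (sSup { s : ℝ | ∃ i : V, s = 2 * H Finset.univ - H {i} - H (Finset.univ \ {i}) })
        ((1 / 2) * ∑ i, (H Finset.univ - H {i}))) ∧
    IsLeast { s : ℝ | ∃ r ∈ RCO H, ∑ i, r i = s }
      (max (sSup { s : ℝ | ∃ i : V, s = 2 * H Finset.univ - H {i} - H (Finset.univ \ {i}) })
        ((1 / 2) * ∑ i, (H Finset.univ - H {i}))) := by
  have : Nonempty V := Fintype.card_pos_iff.1 (by omega)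
  obtain ⟨i₀, hi₀⟩ := Finite.exists_max
    fun i : V => 2 * H Finset.univ - H {i} - H (Finset.univ \ {i})
  have hsup : sSup { s : ℝ | ∃ i : V,
      s = 2 * H Finset.univ - H {i} - H (Finset.univ \ {i}) } =
      2 * H Finset.univ - H {i₀} - H (Finset.univ \ {i₀}) := by
    refine IsGreatest.csSup_eq ⟨⟨i₀, rfl⟩, ?_⟩
    rintro s ⟨i, rfl⟩
    exact hi₀ i
  rw [hsup]
  set M := max (2 * H Finset.univ - H {i₀} - H (Finset.univ \ {i₀}))
    ((1 / 2) * ∑ i, (H Finset.univ - H {i})) with hM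
  obtain ⟨P, hP, hPcard, hPM⟩ : ∃ P : Finset (Finset V),
      IsPartitionOf Finset.univ P ∧ 2 ≤ P.card ∧ M = phi H P := by
    rcases max_choice (2 * H Finset.univ - H {i₀} - H (Finset.univ \ {i₀}))
      ((1 / 2) * ∑ i, (H Finset.univ - H {i})) with h | h <;> rw [hM, h]
    · exact exists_partition_phi_eq_pair (by omega) H i₀
    · exact exists_partition_phi_eq_singletons hV H
  obtain ⟨r, hr, hrM⟩ := exists_mem_RCO_sum_eq hV hH (M := M)
    (fun i => (hi₀ i).trans (le_max_left _ _)) (le_max_right _ _)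
  refine ⟨⟨⟨P, hP, hPcard, hPM⟩, ?_⟩, ⟨r, hr, hrM⟩, ?_⟩
  · rintro s ⟨Q, hQ, hQcard, rfl⟩
    exact hrM ▸ phi_le_sum_of_mem_RCO hr hQ hQcard
  · rintro s ⟨r', hr', rfl⟩
    exact hPM ▸ phi_le_sum_of_mem_RCO hr' hP hPcard
end

section
/- Let H : 2^V → ℝ be a polymatroid rank function on a finite set V, let α ∈ ℝ, and let r ∈ ℝ^V satisfy r(X) ≤ f#_α(X) for all X ⊆ V. Then for every i ∈ V, min { f#_α(X) − r(X) : i ∈ X ⊆ V } = min { ĝ_α(X) − r(X) : i ∈ X ⊆ V }, where ĝ_α is the Dilworth truncation of f#_α; moreover, if X̂ is an inclusion-wise minimal minimizer of the first problem, then X̂ is an inclusion-wise minimal minimizer of the second problem. -/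
/-- `f#_α`: the dual set function, `f#_α(∅) = 0` and `f#_α(X) = α − H(V) + H(X)` for `X ≠ ∅`. -/
noncomputable def fHash {V : Type*} [Fintype V] [DecidableEq V]
    (H : Finset V → ℝ) (α : ℝ) (X : Finset V) : ℝ :=
  if X = ∅ then 0 else α - H Finset.univ + H X

/-- The Dilworth truncation `ĝ_α(X) = min_{P ∈ Π(X)} Σ_{C ∈ P} f#_α(C)` (with `ĝ_α(∅) = 0`,
obtained from the empty partition). -/
noncomputable def dilworth {V : Type*} [Fintype V] [DecidableEq V]
    (H : Finset V → ℝ) (α : ℝ) (X : Finset V) : ℝ :=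
  sInf { s : ℝ | ∃ P : Finset (Finset V), IsPartitionOf X P ∧ s = ∑ C ∈ P, fHash H α C }

/-- The sum of a function over a set splits along any partition of that set. -/
theorem IsPartitionOf.sum_eq {V : Type*} [DecidableEq V] {X : Finset V}
    {P : Finset (Finset V)} (hP : IsPartitionOf X P) (r : V → ℝ) :
    ∑ C ∈ P, ∑ j ∈ C, r j = ∑ j ∈ X, r j := by
  obtain ⟨-, hdisj, hunion⟩ := hP
  rw [← hunion]
  exact (Finset.sum_biUnion fun C hC D hD hne => hdisj C hC D hD hne).symm

/-- A nonempty set is a partition of itself into one block. -/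
theorem isPartitionOf_singleton {V : Type*} [DecidableEq V] {X : Finset V}
    (hX : X.Nonempty) : IsPartitionOf X {X} := by
  refine ⟨?_, ?_, ?_⟩
  · simpa using hX
  · intro C hC D hD hne
    rw [Finset.mem_singleton] at hC hD
    exact absurd (hC.trans hD.symm) hne
  · simp

/-- The values of a real function on part of a finite type form a finite set. -/
theorem finite_setOf_exists_eq {β : Type*} [Finite β] (p : β → Prop) (φ : β → ℝ) :
    {s : ℝ | ∃ x, p x ∧ s = φ x}.Finite :=
  (Set.finite_range φ).subset fun _ ⟨x, _, hs⟩ => ⟨x, hs.symm⟩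

/-- The Dilworth truncation is bounded above by the function itself on nonempty sets. -/
theorem dilworth_le_fHash {V : Type*} [Fintype V] [DecidableEq V] (H : Finset V → ℝ) (α : ℝ)
    {X : Finset V} (hX : X.Nonempty) : dilworth H α X ≤ fHash H α X :=
  csInf_le (finite_setOf_exists_eq _ _).bddBelow
    ⟨{X}, isPartitionOf_singleton hX, (Finset.sum_singleton _ _).symm⟩

/-- The minimum defining the Dilworth truncation at a nonempty set is attained. -/
theorem exists_isPartitionOf_dilworth_eq {V : Type*} [Fintype V] [DecidableEq V]
    (H : Finset V → ℝ) (α : ℝ) {X : Finset V} (hX : X.Nonempty) :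
    ∃ P, IsPartitionOf X P ∧ dilworth H α X = ∑ C ∈ P, fHash H α C :=
  Set.Nonempty.csInf_mem
    (s := {s : ℝ | ∃ P : Finset (Finset V), IsPartitionOf X P ∧ s = ∑ C ∈ P, fHash H α C})
    ⟨_, {X}, isPartitionOf_singleton hX, rfl⟩ (finite_setOf_exists_eq _ _)

/-- If `r` is dominated by `f#_α`, the block containing `i` of an optimal partition of `X` has
slack for `f#_α` at most the slack of `X` for the Dilworth truncation. -/
theorem exists_subset_slack_le {V : Type*} [Fintype V] [DecidableEq V]
    (H : Finset V → ℝ) (α : ℝ) (r : V → ℝ) (hr : ∀ X : Finset V, ∑ j ∈ X, r j ≤ fHash H α X)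
    {i : V} {X : Finset V} (hi : i ∈ X) :
    ∃ C, i ∈ C ∧ C ⊆ X ∧
      fHash H α C - ∑ j ∈ C, r j ≤ dilworth H α X - ∑ j ∈ X, r j := by
  obtain ⟨P, hP, hval⟩ := exists_isPartitionOf_dilworth_eq H α ⟨i, hi⟩
  obtain ⟨C, hC, hiC⟩ : ∃ C ∈ P, i ∈ C := by
    simpa [← hP.2.2] using hi
  refine ⟨C, hiC, ?_, ?_⟩
  · rw [← hP.2.2]
    exact Finset.subset_biUnion_of_mem id hC
  · rw [hval, ← hP.sum_eq r, ← Finset.sum_sub_distrib]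
    exact Finset.single_le_sum (f := fun C => fHash H α C - ∑ j ∈ C, r j)
      (fun D _ => sub_nonneg.2 (hr D)) hC

/-- Let `γ ≤ φ` on the sets containing `i`, and let every such set `X` contain a set `C ∋ i` with
`φ C ≤ γ X`. Then `φ` and `γ` have the same minimum over the sets containing `i`, and minimal
minimizers of `φ` are minimal minimizers of `γ`. -/
theorem sInf_eq_and_minimal_minimizer {V : Type*} [Fintype V] (φ γ : Finset V → ℝ) (i : V)
    (hle : ∀ X, i ∈ X → γ X ≤ φ X) (hex : ∀ X, i ∈ X → ∃ C, i ∈ C ∧ C ⊆ X ∧ φ C ≤ γ X) :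
    sInf {s : ℝ | ∃ X, i ∈ X ∧ s = φ X} = sInf {s : ℝ | ∃ X, i ∈ X ∧ s = γ X} ∧
      ∀ Z, (i ∈ Z ∧ φ Z = sInf {s : ℝ | ∃ X, i ∈ X ∧ s = φ X} ∧
          ∀ Y, i ∈ Y → Y ⊆ Z → φ Y = sInf {s : ℝ | ∃ X, i ∈ X ∧ s = φ X} → Y = Z) →
        (i ∈ Z ∧ γ Z = sInf {s : ℝ | ∃ X, i ∈ X ∧ s = γ X} ∧
          ∀ Y, i ∈ Y → Y ⊆ Z → γ Y = sInf {s : ℝ | ∃ X, i ∈ X ∧ s = γ X} → Y = Z) := by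
  have hφ : ∀ X, i ∈ X → sInf {s : ℝ | ∃ X, i ∈ X ∧ s = φ X} ≤ φ X := fun X hX =>
    csInf_le (finite_setOf_exists_eq _ _).bddBelow ⟨X, hX, rfl⟩
  have hγ : ∀ X, i ∈ X → sInf {s : ℝ | ∃ X, i ∈ X ∧ s = γ X} ≤ γ X := fun X hX =>
    csInf_le (finite_setOf_exists_eq _ _).bddBelow ⟨X, hX, rfl⟩
  have heq : sInf {s : ℝ | ∃ X, i ∈ X ∧ s = φ X} = sInf {s : ℝ | ∃ X, i ∈ X ∧ s = γ X} := by
    apply le_antisymm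
    · refine le_csInf ⟨_, Finset.univ, Finset.mem_univ i, rfl⟩ ?_
      rintro _ ⟨X, hX, rfl⟩
      obtain ⟨C, hiC, -, hC⟩ := hex X hX
      exact (hφ C hiC).trans hC
    · refine le_csInf ⟨_, Finset.univ, Finset.mem_univ i, rfl⟩ ?_
      rintro _ ⟨X, hX, rfl⟩
      exact (hγ X hX).trans (hle X hX)
  refine ⟨heq, ?_⟩
  rintro Z ⟨hiZ, hZ, hmin⟩
  refine ⟨hiZ, le_antisymm ?_ (hγ Z hiZ), ?_⟩
  · rw [← heq, ← hZ]
    exact hle Z hiZ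
  · intro Y hiY hYZ hY
    obtain ⟨C, hiC, hCY, hC⟩ := hex Y hiY
    have hCZ : C = Z :=
      hmin C hiC (hCY.trans hYZ) (le_antisymm (by rwa [heq, ← hY]) (hφ C hiC))
    exact hYZ.antisymm (hCZ ▸ hCY)

/-- For `r` in the polyhedron `P(f#_α, ≤)`, the saturation capacity at `i` for `f#_α`
coincides with that for the Dilworth truncation `ĝ_α`, and any inclusion-wise minimal
minimizer of the former is an inclusion-wise minimal minimizer of the latter. -/
theorem stmt_14 {V : Type*} [Fintype V] [DecidableEq V]
    (H : Finset V → ℝ) (hH : IsPolymatroid H) (α : ℝ)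
    (r : V → ℝ) (hr : ∀ X : Finset V, ∑ j ∈ X, r j ≤ fHash H α X) :
    ∀ i : V,
      sInf { s : ℝ | ∃ X : Finset V, i ∈ X ∧ s = fHash H α X - ∑ j ∈ X, r j } =
        sInf { s : ℝ | ∃ X : Finset V, i ∈ X ∧ s = dilworth H α X - ∑ j ∈ X, r j } ∧
      ∀ Xhat : Finset V,
        (i ∈ Xhat ∧
         fHash H α Xhat - ∑ j ∈ Xhat, r j =
           sInf { s : ℝ | ∃ X : Finset V, i ∈ X ∧ s = fHash H α X - ∑ j ∈ X, r j } ∧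
         (∀ Y : Finset V, i ∈ Y → Y ⊆ Xhat →
           fHash H α Y - ∑ j ∈ Y, r j =
             sInf { s : ℝ | ∃ X : Finset V, i ∈ X ∧ s = fHash H α X - ∑ j ∈ X, r j } →
           Y = Xhat)) →
        (i ∈ Xhat ∧
         dilworth H α Xhat - ∑ j ∈ Xhat, r j =
           sInf { s : ℝ | ∃ X : Finset V, i ∈ X ∧ s = dilworth H α X - ∑ j ∈ X, r j } ∧
         (∀ Y : Finset V, i ∈ Y → Y ⊆ Xhat →
           dilworth H α Y - ∑ j ∈ Y, r j =
             sInf { s : ℝ | ∃ X : Finset V, i ∈ X ∧ s = dilworth H α X - ∑ j ∈ X, r j } →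
           Y = Xhat)) := by
  intro i
  exact sInf_eq_and_minimal_minimizer (fun X => fHash H α X - ∑ j ∈ X, r j)
    (fun X => dilworth H α X - ∑ j ∈ X, r j) i
    (fun X hX => sub_le_sub_right (dilworth_le_fHash H α ⟨i, hX⟩) _)
    (fun X hX => exists_subset_slack_le H α r hr hX)
end

section
/- Let H : 2^V → ℝ be a polymatroid rank function on a finite set V with |V| ≥ 2, let R := max_{P ∈ Π′(V)} φ(P), and let P* ∈ Π′(V) be the fundamental partition, i.e., φ(P*) = R and for every P ∈ Π′(V) with φ(P) = R, the partition P* refines P (every block of P* is contained in some block of P). Then P* is the set of minimal separators of the Dilworth truncation ĝ_R: every C ∈ P* is a separator of ĝ_R (ĝ_R(C) + ĝ_R(V∖C) = ĝ_R(V)), and for every C ∈ P*, no nonempty proper subset X ⊊ C is a separator of ĝ_R (ĝ_R(X) + ĝ_R(V∖X) ≠ ĝ_R(V)). -/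
section Dilworth

variable {V : Type*} [DecidableEq V]

theorem exists_isPartitionOf (X : Finset V) : ∃ P, IsPartitionOf X P := by
  rcases X.eq_empty_or_nonempty with rfl | hX
  · exact ⟨∅, by simp [IsPartitionOf]⟩
  · exact ⟨{X}, by simp [IsPartitionOf, hX]⟩

theorem IsPartitionOf.subset {X : Finset V} {P : Finset (Finset V)} (hP : IsPartitionOf X P)
    {C : Finset V} (hC : C ∈ P) : C ⊆ X :=
  hP.2.2 ▸ Finset.subset_biUnion_of_mem id hC

theorem IsPartitionOf.disjoint {X Y : Finset V} {P Q : Finset (Finset V)}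
    (hP : IsPartitionOf X P) (hQ : IsPartitionOf Y Q) (hXY : Disjoint X Y) : Disjoint P Q := by
  refine Finset.disjoint_left.2 fun C hCP hCQ => (hP.1 C hCP).ne_empty ?_
  exact Finset.disjoint_self_iff_empty C |>.1
    (Finset.disjoint_of_subset_left (hP.subset hCP)
      (Finset.disjoint_of_subset_right (hQ.subset hCQ) hXY))

theorem IsPartitionOf.union {X Y : Finset V} {P Q : Finset (Finset V)}
    (hP : IsPartitionOf X P) (hQ : IsPartitionOf Y Q) (hXY : Disjoint X Y) :
    IsPartitionOf (X ∪ Y) (P ∪ Q) := by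
  refine ⟨?_, ?_, ?_⟩
  · intro C hC
    exact (Finset.mem_union.1 hC).elim (hP.1 C) (hQ.1 C)
  · intro C hC D hD hCD
    rcases Finset.mem_union.1 hC with hC | hC <;> rcases Finset.mem_union.1 hD with hD | hD
    · exact hP.2.1 C hC D hD hCD
    · exact Finset.disjoint_of_subset_left (hP.subset hC)
        (Finset.disjoint_of_subset_right (hQ.subset hD) hXY)
    · exact Finset.disjoint_of_subset_left (hQ.subset hC)
        (Finset.disjoint_of_subset_right (hP.subset hD) hXY.symm)
    · exact hQ.2.1 C hC D hD hCD
  · rw [Finset.union_biUnion, hP.2.2, hQ.2.2]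

theorem IsPartitionOf.erase {X : Finset V} {P : Finset (Finset V)} (hP : IsPartitionOf X P)
    {C : Finset V} (hC : C ∈ P) : IsPartitionOf (X \ C) (P.erase C) := by
  refine ⟨fun D hD => hP.1 D (Finset.mem_of_mem_erase hD), fun D hD E hE =>
    hP.2.1 D (Finset.mem_of_mem_erase hD) E (Finset.mem_of_mem_erase hE), ?_⟩
  ext v
  simp only [Finset.mem_biUnion, Finset.mem_erase, id, Finset.mem_sdiff]
  constructor
  · rintro ⟨D, ⟨hDC, hD⟩, hv⟩
    exact ⟨hP.subset hD hv, Finset.disjoint_left.1 (hP.2.1 D hD C hC hDC) hv⟩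
  · rintro ⟨hv, hvC⟩
    rw [← hP.2.2] at hv
    obtain ⟨D, hD, hvD⟩ := Finset.mem_biUnion.1 hv
    exact ⟨D, ⟨fun h => hvC (h ▸ hvD), hD⟩, hvD⟩

variable [Fintype V]

theorem finite_partition_sums (H : Finset V → ℝ) (α : ℝ) (X : Finset V) :
    { s : ℝ | ∃ P : Finset (Finset V), IsPartitionOf X P ∧ s = ∑ C ∈ P, fHash H α C }.Finite := by
  refine (Set.finite_range fun P : Finset (Finset V) => ∑ C ∈ P, fHash H α C).subset ?_
  rintro s ⟨P, -, rfl⟩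
  exact ⟨P, rfl⟩

theorem dilworth_le (H : Finset V → ℝ) (α : ℝ) {X : Finset V} {P : Finset (Finset V)}
    (hP : IsPartitionOf X P) : dilworth H α X ≤ ∑ C ∈ P, fHash H α C :=
  csInf_le (finite_partition_sums H α X).bddBelow ⟨P, hP, rfl⟩

theorem exists_dilworth_eq (H : Finset V → ℝ) (α : ℝ) (X : Finset V) :
    ∃ P, IsPartitionOf X P ∧ dilworth H α X = ∑ C ∈ P, fHash H α C := by
  obtain ⟨P, hP⟩ := exists_isPartitionOf X
  have hne : { s : ℝ | ∃ P : Finset (Finset V),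
      IsPartitionOf X P ∧ s = ∑ C ∈ P, fHash H α C }.Nonempty := ⟨_, P, hP, rfl⟩
  exact hne.csInf_mem (finite_partition_sums H α X)

theorem dilworth_union_le (H : Finset V → ℝ) (α : ℝ) {X Y : Finset V} (hXY : Disjoint X Y) :
    dilworth H α (X ∪ Y) ≤ dilworth H α X + dilworth H α Y := by
  obtain ⟨P, hP, hPX⟩ := exists_dilworth_eq H α X
  obtain ⟨Q, hQ, hQY⟩ := exists_dilworth_eq H α Y
  rw [hPX, hQY, ← Finset.sum_union (hP.disjoint hQ hXY)]
  exact dilworth_le H α (hP.union hQ hXY)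

theorem sum_fHash_eq (H : Finset V → ℝ) (α : ℝ) {X : Finset V} {P : Finset (Finset V)}
    (hP : IsPartitionOf X P) (hcard : 2 ≤ P.card) :
    ∑ C ∈ P, fHash H α C = α + ((P.card : ℝ) - 1) * (α - phi H P) := by
  have hc : (2 : ℝ) ≤ P.card := by exact_mod_cast hcard
  have hne : (P.card : ℝ) - 1 ≠ 0 := by linarith
  have hphi : ((P.card : ℝ) - 1) * phi H P = ∑ C ∈ P, (H Finset.univ - H C) :=
    mul_div_cancel₀ _ hne
  have hsum : ∑ C ∈ P, fHash H α C = ∑ C ∈ P, (α - (H Finset.univ - H C)) := by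
    refine Finset.sum_congr rfl fun C hC => ?_
    rw [fHash, if_neg (hP.1 C hC).ne_empty]
    ring
  rw [hsum, Finset.sum_sub_distrib, ← hphi, Finset.sum_const, nsmul_eq_mul]
  ring

theorem dilworth_univ_eq [Nonempty V] (H : Finset V → ℝ) (R : ℝ)
    (hR : ∀ P : Finset (Finset V), IsPartitionOf Finset.univ P → 2 ≤ P.card → phi H P ≤ R) :
    dilworth H R Finset.univ = R := by
  have hsingle : ∑ C ∈ {(Finset.univ : Finset V)}, fHash H R C = R := by
    simp [fHash, Finset.univ_nonempty.ne_empty]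
  apply le_antisymm
  · have hP : IsPartitionOf (Finset.univ : Finset V) {Finset.univ} := by
      simp [IsPartitionOf, Finset.univ_nonempty]
    exact (dilworth_le H R hP).trans_eq hsingle
  · obtain ⟨P, hP, hPeq⟩ := exists_dilworth_eq H R (Finset.univ : Finset V)
    rw [hPeq]
    by_cases hcard : 2 ≤ P.card
    · rw [sum_fHash_eq H R hP hcard]
      have hc : (2 : ℝ) ≤ P.card := by exact_mod_cast hcard
      nlinarith [hR P hP hcard]
    · have hne : P.Nonempty := by
        rw [Finset.nonempty_iff_ne_empty]
        rintro rfl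
        exact Finset.univ_nonempty.ne_empty (hP.2.2.symm.trans Finset.biUnion_empty)
      obtain ⟨D, rfl⟩ := Finset.card_eq_one.1 (by have := hne.card_pos; omega : P.card = 1)
      have hD : D = Finset.univ := by simpa using hP.2.2
      rw [hD, hsingle]

end Dilworth

/-- The fundamental partition `P*` is the set of minimal separators of `ĝ_R`: every block
of `P*` is a separator of `ĝ_R`, and no nonempty proper subset of a block is a separator. -/
theorem stmt_16 {V : Type*} [Fintype V] [DecidableEq V] (hV : 2 ≤ Fintype.card V)
    (H : Finset V → ℝ) (hH : IsPolymatroid H) (R : ℝ)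
    (hR : IsGreatest { s : ℝ | ∃ P : Finset (Finset V),
      IsPartitionOf Finset.univ P ∧ 2 ≤ P.card ∧ s = phi H P } R)
    (Pstar : Finset (Finset V)) (hPstar : IsPartitionOf Finset.univ Pstar)
    (hPstar2 : 2 ≤ Pstar.card) (hPopt : phi H Pstar = R)
    (hfinest : ∀ P : Finset (Finset V), IsPartitionOf Finset.univ P → 2 ≤ P.card →
      phi H P = R → ∀ C ∈ Pstar, ∃ D ∈ P, C ⊆ D) :
    (∀ C ∈ Pstar,
      dilworth H R C + dilworth H R (Finset.univ \ C) = dilworth H R Finset.univ) ∧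
    (∀ C ∈ Pstar, ∀ X : Finset V, X.Nonempty → X ⊂ C →
      dilworth H R X + dilworth H R (Finset.univ \ X) ≠ dilworth H R Finset.univ) := by
  have : Nonempty V := Fintype.card_pos_iff.1 (by omega)
  have huniv : dilworth H R Finset.univ = R :=
    dilworth_univ_eq H R fun P hP hcard => hR.2 ⟨P, hP, hcard, rfl⟩
  refine ⟨fun C hC => le_antisymm ?_ ?_, fun C hC X hX hXC heq => ?_⟩
  · have hsingle : IsPartitionOf C {C} := by simp [IsPartitionOf, hPstar.1 C hC]
    have hle := add_le_add (dilworth_le H R hsingle) (dilworth_le H R (hPstar.erase hC))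
    rw [Finset.sum_singleton, Finset.add_sum_erase _ _ hC, sum_fHash_eq H R hPstar hPstar2,
      hPopt] at hle
    linarith
  · have h := dilworth_union_le H R (Finset.disjoint_sdiff (s := C) (t := Finset.univ))
    rwa [Finset.union_sdiff_of_subset (Finset.subset_univ C)] at h
  · have hdisj : Disjoint X (Finset.univ \ X) := Finset.disjoint_sdiff
    obtain ⟨P, hP, hPX⟩ := exists_dilworth_eq H R X
    obtain ⟨Q, hQ, hQX⟩ := exists_dilworth_eq H R (Finset.univ \ X)
    have hPQ := hP.union hQ hdisj
    rw [Finset.union_sdiff_of_subset (Finset.subset_univ X)] at hPQ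
    have hPne : P.Nonempty := by
      rw [Finset.nonempty_iff_ne_empty]
      rintro rfl
      exact hX.ne_empty (hP.2.2.symm.trans Finset.biUnion_empty)
    obtain ⟨v, -, hvX⟩ := Finset.exists_of_ssubset hXC
    have hQne : Q.Nonempty := by
      rw [Finset.nonempty_iff_ne_empty]
      rintro rfl
      have hv : v ∈ Finset.univ \ X := by simpa using hvX
      rw [← hQ.2.2] at hv
      simp at hv
    have hcard : 2 ≤ (P ∪ Q).card := by
      rw [Finset.card_union_of_disjoint (hP.disjoint hQ hdisj)]
      have := hPne.card_pos
      have := hQne.card_pos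
      omega
    have hphi : phi H (P ∪ Q) = R := by
      have hsum := sum_fHash_eq H R hPQ hcard
      rw [Finset.sum_union (hP.disjoint hQ hdisj), ← hPX, ← hQX, heq, huniv] at hsum
      have hc : (2 : ℝ) ≤ (P ∪ Q).card := by exact_mod_cast hcard
      rcases mul_eq_zero.1 (left_eq_add.1 hsum) with h | h <;> linarith
    obtain ⟨D, hD, hCD⟩ := hfinest _ hPQ hcard hphi C hC
    rcases Finset.mem_union.1 hD with hD | hD
    · exact hXC.2 (hCD.trans (hP.subset hD))
    · obtain ⟨x, hx⟩ := hX
      exact (Finset.mem_sdiff.1 (hQ.subset hD (hCD (hXC.1 hx)))).2 hx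
end
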